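/- arXiv:2603.12985 — 2 statements merged into one kernel-verified Lean document; each statement's English description precedes it below -/
import Mathlib

section
/- Let f : ℝ[x,y] be a polynomial in two variables, let a < b be real numbers, and suppose that (i) for every x ∈ (a,b) and y ∈ ℝ, it is not the case that both f(x,y) = 0 and ∂f/∂y(x,y) = 0, and (ii) the leading coefficient of f, viewed as a polynomial in y with coefficients in ℝ[x], does not vanish at any x ∈ [a,b]. Then the number of distinct real roots of the univariate polynomial y ↦ f(x,y) is the same for every x ∈ (a,b). -/
open Polynomial in
/-- Evaluation of a bivariate polynomial is jointly continuous. -/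
theorem continuous_eval_map_evalRingHom (f : ℝ[X][X]) :
    Continuous fun p : ℝ × ℝ => eval p.2 (f.map (evalRingHom p.1)) := by
  simp only [eval_map, eval₂_eq_sum_range, coe_evalRingHom]
  fun_prop

open Polynomial Topology in
/-- The real roots of `f(x, ·)` are locally bounded wherever the leading coefficient of `f`
does not vanish. -/
theorem exists_eventually_abs_root_le (f : ℝ[X][X]) {x₀ : ℝ} (h : f.leadingCoeff.eval x₀ ≠ 0) :
    ∃ M : ℝ, ∀ᶠ x in 𝓝 x₀, ∀ y, eval y (f.map (evalRingHom x)) = 0 → |y| ≤ M := by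
  let B : ℝ → NNReal := fun x =>
    (Finset.range f.natDegree).sup (fun i => ‖(f.coeff i).eval x‖₊) / ‖f.leadingCoeff.eval x‖₊ + 1
  have hB : ContinuousAt B x₀ := by
    have hsup : Continuous fun x : ℝ =>
        (Finset.range f.natDegree).sup (fun i => ‖(f.coeff i).eval x‖₊) :=
      Continuous.finset_sup_apply fun i _ => (f.coeff i).continuous.nnnorm
    have hlc : Continuous fun x : ℝ => ‖f.leadingCoeff.eval x‖₊ := f.leadingCoeff.continuous.nnnorm
    exact (hsup.continuousAt.div hlc.continuousAt (by simpa using h)).add continuousAt_const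
  refine ⟨B x₀ + 1, ?_⟩
  have hlt : ∀ᶠ x in 𝓝 x₀, B x < B x₀ + 1 := hB.eventually_lt_const (by simp)
  filter_upwards [hlt, f.leadingCoeff.continuous.continuousAt.eventually_ne h] with x hx hne y hy
  have hne' : evalRingHom x f.leadingCoeff ≠ 0 := hne
  have hdeg := natDegree_map_of_leadingCoeff_ne_zero _ hne'
  have hmap : f.map (evalRingHom x) ≠ 0 := fun h0 => hne' (by
    simpa [h0] using (coeff_map (p := f) (evalRingHom x) f.natDegree).symm)
  have hroot := IsRoot.norm_lt_cauchyBound hmap hy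
  have hBx : cauchyBound (f.map (evalRingHom x)) = B x := by
    simp [cauchyBound, B, hdeg, leadingCoeff_map_of_leadingCoeff_ne_zero _ hne']
  rw [hBx] at hroot
  have : ‖y‖₊ ≤ B x₀ + 1 := (hroot.trans hx).le
  exact_mod_cast this

open Polynomial Filter Topology in
/-- A simple root `s` of `f(x₀, ·)` persists: for `x` near `x₀`, `f(x, ·)` has a root near `s`. -/
theorem eventually_exists_root_mem (f : ℝ[X][X]) {x₀ s : ℝ}
    (hs : eval s (f.map (evalRingHom x₀)) = 0)
    (hs' : eval s ((derivative f).map (evalRingHom x₀)) ≠ 0) {U : Set ℝ} (hU : U ∈ 𝓝 s) :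
    ∀ᶠ x in 𝓝 x₀, ∃ y ∈ U, eval y (f.map (evalRingHom x)) = 0 := by
  obtain ⟨r, hr, hrU⟩ := Metric.mem_nhds_iff.1 hU
  have hd := (f.map (evalRingHom x₀)).hasStrictDerivAt s
  rw [derivative_map] at hd
  have himg := image_mem_map (m := fun y => eval y (f.map (evalRingHom x₀)))
    (Metric.ball_mem_nhds s hr)
  rw [hd.map_nhds_eq hs', hs] at himg
  obtain ⟨δ, hδ, hδs⟩ := Metric.mem_nhds_iff.1 himg
  obtain ⟨y₁, hy₁, h₁⟩ := hδs (show -(δ / 2) ∈ Metric.ball (0 : ℝ) δ by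
    simp [abs_of_pos hδ, hδ])
  obtain ⟨y₂, hy₂, h₂⟩ := hδs (show δ / 2 ∈ Metric.ball (0 : ℝ) δ by
    simp [abs_of_pos hδ, hδ])
  have hc (y : ℝ) : ContinuousAt (fun x => eval y (f.map (evalRingHom x))) x₀ :=
    ((continuous_eval_map_evalRingHom f).comp (Continuous.prodMk_left y)).continuousAt
  filter_upwards [(hc y₁).eventually_lt_const (show _ < (0 : ℝ) by dsimp only at h₁ ⊢; linarith),
    (hc y₂).eventually_const_lt (show (0 : ℝ) < _ by dsimp only at h₂ ⊢; linarith)] with x hx₁ hx₂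
  obtain ⟨y, hy, hy0⟩ := (convex_ball s r).isPreconnected.intermediate_value hy₁ hy₂
    (f.map (evalRingHom x)).continuous.continuousOn ⟨hx₁.le, hx₂.le⟩
  exact ⟨y, hrU hy, hy0⟩

open Polynomial Filter Topology in
/-- Near a point where `∂f/∂y` does not vanish, `f(x, ·)` has at most one root. -/
theorem exists_nhds_eventually_root_unique (f : ℝ[X][X]) {x₀ s : ℝ}
    (hs' : eval s ((derivative f).map (evalRingHom x₀)) ≠ 0) :
    ∃ V ∈ 𝓝 s, ∀ᶠ x in 𝓝 x₀, ∀ y ∈ V, ∀ z ∈ V, eval y (f.map (evalRingHom x)) = 0 →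
      eval z (f.map (evalRingHom x)) = 0 → y = z := by
  have hev := (continuous_eval_map_evalRingHom (derivative f)).continuousAt.eventually_ne
    (x := (x₀, s)) hs'
  rw [nhds_prod_eq] at hev
  obtain ⟨p, hp, q, hq, hpq⟩ := eventually_prod_iff.1 hev
  obtain ⟨r, hr, hrq⟩ := Metric.mem_nhds_iff.1 hq
  refine ⟨Metric.ball s r, Metric.ball_mem_nhds s hr, ?_⟩
  filter_upwards [hp] with x hx
  have hne {y z : ℝ} (hy : y ∈ Metric.ball s r) (hz : z ∈ Metric.ball s r)
      (hy0 : eval y (f.map (evalRingHom x)) = 0) (hz0 : eval z (f.map (evalRingHom x)) = 0) :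
      ¬ y < z := fun hlt => by
    obtain ⟨c, hc, hc0⟩ := exists_hasDerivAt_eq_zero hlt
      (f.map (evalRingHom x)).continuous.continuousOn (hy0.trans hz0.symm)
      fun c _ => (f.map (evalRingHom x)).hasDerivAt c
    rw [derivative_map] at hc0
    exact hpq hx (hrq ((convex_ball s r).ordConnected.out hy hz ⟨hc.1.le, hc.2.le⟩)) hc0
  exact fun y hy z hz hy0 hz0 => le_antisymm (not_lt.1 (hne hz hy hz0 hy0))
    (not_lt.1 (hne hy hz hy0 hz0))

open Polynomial Filter Topology in
/-- If the leading coefficient does not vanish at `x₀`, then for `x` near `x₀` all real roots of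
`f(x, ·)` lie in a given open set containing the real roots of `f(x₀, ·)`. -/
theorem eventually_root_mem_of_isOpen (f : ℝ[X][X]) {x₀ : ℝ} (h : f.leadingCoeff.eval x₀ ≠ 0)
    {V : Set ℝ} (hV : IsOpen V) (hsub : ∀ y, eval y (f.map (evalRingHom x₀)) = 0 → y ∈ V) :
    ∀ᶠ x in 𝓝 x₀, ∀ y, eval y (f.map (evalRingHom x)) = 0 → y ∈ V := by
  obtain ⟨M, hM⟩ := exists_eventually_abs_root_le f h
  have hK : IsCompact (Set.Icc (-M) M \ V) := isCompact_Icc.diff hV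
  have hne : ∀ᶠ x in 𝓝 x₀, ∀ y ∈ Set.Icc (-M) M \ V, eval y (f.map (evalRingHom x)) ≠ 0 :=
    hK.eventually_forall_of_forall_eventually fun y hy =>
      (continuous_eval_map_evalRingHom f).continuousAt.eventually_ne (x := (x₀, y))
        fun h0 => hy.2 (hsub y h0)
  filter_upwards [hM, hne] with x hx hx' y hy
  by_contra hyV
  exact hx' y ⟨abs_le.1 (hx y hy), hyV⟩ hy

open Polynomial Filter Topology in
/-- The number of real roots of `f(x, ·)` is locally constant at `x₀` if the leading coefficient of
`f` does not vanish at `x₀` and all real roots of `f(x₀, ·)` are simple. -/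
theorem eventually_ncard_roots_eq (f : ℝ[X][X]) {x₀ : ℝ} (h : f.leadingCoeff.eval x₀ ≠ 0)
    (hcrit : ∀ y, eval y (f.map (evalRingHom x₀)) = 0 →
      eval y ((derivative f).map (evalRingHom x₀)) ≠ 0) :
    ∀ᶠ x in 𝓝 x₀, {y : ℝ | eval y (f.map (evalRingHom x)) = 0}.ncard =
      {y : ℝ | eval y (f.map (evalRingHom x₀)) = 0}.ncard := by
  set S := {y : ℝ | eval y (f.map (evalRingHom x₀)) = 0}
  have hfin : S.Finite := by
    refine finite_setOfPred_isRoot fun h0 => h ?_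
    simpa [h0] using (coeff_map (p := f) (evalRingHom x₀) f.natDegree).symm
  obtain ⟨U, hU, hdisj⟩ := hfin.t2_separation
  have hV : ∀ s : S, ∃ V ∈ 𝓝 (s : ℝ), ∀ᶠ x in 𝓝 x₀, ∀ y ∈ V, ∀ z ∈ V,
      eval y (f.map (evalRingHom x)) = 0 → eval z (f.map (evalRingHom x)) = 0 → y = z :=
    fun s => exists_nhds_eventually_root_unique f (hcrit s s.2)
  choose V hVs hVu using hV
  let W : S → Set ℝ := fun s => U s ∩ interior (V s)
  have hWo (s : S) : IsOpen (W s) := (hU s).2.inter isOpen_interior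
  have hWs (s : S) : (s : ℝ) ∈ W s := ⟨(hU s).1, mem_interior_iff_mem_nhds.2 (hVs s)⟩
  have : Finite S := hfin
  have hex : ∀ᶠ x in 𝓝 x₀, ∀ s : S, ∃ y ∈ W s, eval y (f.map (evalRingHom x)) = 0 :=
    eventually_all.2 fun s =>
      eventually_exists_root_mem f s.2 (hcrit s s.2) ((hWo s).mem_nhds (hWs s))
  have hcov := eventually_root_mem_of_isOpen f h (isOpen_iUnion hWo)
    fun y hy => Set.mem_iUnion.2 ⟨⟨y, hy⟩, hWs ⟨y, hy⟩⟩
  filter_upwards [hex, eventually_all.2 hVu, hcov] with x hx hu hc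
  choose g hgW hg0 using hx
  refine (Nat.card_congr (Equiv.ofBijective
    (fun s => (⟨g s, hg0 s⟩ : {y : ℝ | eval y (f.map (evalRingHom x)) = 0})) ⟨?_, ?_⟩)).symm
  · intro s t hst
    have hst' : g s = g t := congrArg Subtype.val hst
    by_contra hne
    exact Set.disjoint_left.1 (hdisj s.2 t.2 fun he => hne (Subtype.ext he)) (hgW s).1
      (hst' ▸ (hgW t).1)
  · rintro ⟨y, hy⟩
    obtain ⟨s, hs⟩ := Set.mem_iUnion.1 (hc y hy)
    exact ⟨s, Subtype.ext (hu s _ (interior_subset (hgW s).2) _ (interior_subset hs.2)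
      (hg0 s) hy)⟩


/-- If `f ∈ ℝ[x][y]` (a bivariate real polynomial, viewed as a polynomial
in `y` with coefficients in `ℝ[x]`), `a < b`, there is no critical point
(`f = 0 ∧ ∂f/∂y = 0`) over `x ∈ (a,b)`, and the leading coefficient of `f` in `y`
does not vanish on `[a,b]`, then the number of distinct real roots of `y ↦ f(x,y)`
is constant for `x ∈ (a,b)`. -/
theorem constant_fiber_count_on_critical_free_interval
    (f : Polynomial (Polynomial ℝ)) (a b : ℝ) (hab : a < b)
    (hcrit : ∀ x ∈ Set.Ioo a b, ∀ y : ℝ,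
      ¬ (Polynomial.eval y (f.map (Polynomial.evalRingHom x)) = 0 ∧
         Polynomial.eval y ((Polynomial.derivative f).map (Polynomial.evalRingHom x)) = 0))
    (hlead : ∀ x ∈ Set.Icc a b, Polynomial.eval x f.leadingCoeff ≠ 0) :
    ∀ x₁ ∈ Set.Ioo a b, ∀ x₂ ∈ Set.Ioo a b,
      {y : ℝ | Polynomial.eval y (f.map (Polynomial.evalRingHom x₁)) = 0}.ncard =
      {y : ℝ | Polynomial.eval y (f.map (Polynomial.evalRingHom x₂)) = 0}.ncard := by
  intro x₁ h₁ x₂ h₂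
  refine isPreconnected_Ioo.constant
    (f := fun x => {y : ℝ | Polynomial.eval y (f.map (Polynomial.evalRingHom x)) = 0}.ncard)
    (fun x hx => ContinuousAt.continuousWithinAt ?_) h₁ h₂
  exact continuousAt_const.congr ((eventually_ncard_roots_eq f
    (hlead x (Set.Ioo_subset_Icc_self hx)) fun y h h' => hcrit x hx y ⟨h, h'⟩).mono
      fun _ h => h.symm)
end

section
/- Let f : ℝ² → ℝ be continuously differentiable, and suppose the zero set V = {(x,y) ∈ ℝ² : f(x,y) = 0} is nonempty and compact. Then there exists a point (x₀,y₀) ∈ V with ∂f/∂y(x₀,y₀) = 0; that is, V contains a critical point of f with respect to vertical projection. -/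
/-- If `f : ℝ² → ℝ` is `C¹` and its zero set is nonempty and compact, then
the zero set contains a point where `∂f/∂y` vanishes, i.e. a critical point with respect
to vertical projection. -/
theorem compact_curve_has_vertical_critical_point
    (f : ℝ × ℝ → ℝ) (hf : ContDiff ℝ 1 f)
    (hne : {p : ℝ × ℝ | f p = 0}.Nonempty)
    (hcpt : IsCompact {p : ℝ × ℝ | f p = 0}) :
    ∃ p : ℝ × ℝ, f p = 0 ∧ fderiv ℝ f p (0, 1) = 0 := by
  obtain ⟨p, hp, hmax⟩ := hcpt.exists_isMaxOn hne continuous_fst.continuousOn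
  refine ⟨p, hp, ?_⟩
  have hp0 : f p = 0 := hp
  have hloc : IsLocalExtrOn Prod.fst {q | f q = f p} p := by
    rw [hp0]
    exact Or.inr hmax.localize
  obtain ⟨a, b, hab, h⟩ := hloc.exists_multipliers_of_hasStrictFDerivAt_1d
    (hf.contDiffAt.hasStrictFDerivAt one_ne_zero) hasStrictFDerivAt_fst
  have ha : a ≠ 0 := by
    rintro rfl
    have h1 := DFunLike.congr_fun h (1, 0)
    simp at h1
    exact hab (by rw [h1]; rfl)
  have h2 := DFunLike.congr_fun h (0, 1)
  simpa [ha] using h2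
end
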